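/- arXiv:1511.00176 — 5 statements merged into one kernel-verified Lean document; each statement's English description precedes it below -/
import Mathlib

section
/- Define the Harder–Narasimhan filtration of N by F^HN_β(N) := the ℂ[z,z⁻¹]-span of V_β ∩ M, and F^HN_{<β}(N) := ⋃_{β′<β} F^HN_{β′}(N). Then for all β, γ ∈ ℝ with β − γ ∉ ℤ one has F^HN_β(N) ∩ V_γ ⊆ F^HN_{<β}(N) + V_{<γ}; equivalently, the filtration induced by F^HN on the graded piece gr^V_γ N := V_γ/V_{<γ} has zero β-graded piece whenever β − γ ∉ ℤ. (Lemma 3.2.6, first part, of 'Irregular Hodge theory'.) -/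
noncomputable section

open Submodule Set

variable {N : Type*} [AddCommGroup N] [Module ℂ N]

/-- `M` is (the image of) a finite free `ℂ[z]`-module of rank `r` inside
`N = ℂ[z,z⁻¹] ⊗_{ℂ[z]} M`, where multiplication by `z` is the automorphism `z` of `N`.
This is encoded by `z`-stability of `M` together with the existence of an `r`-element
family `b` of elements of `M` such that `(z^k (b i))` for `k ∈ ℤ` is a `ℂ`-basis of `N`
and `(z^k (b i))` for `k ∈ ℕ` is a `ℂ`-basis of `M`. -/
def IsFreeLattice (z : N ≃ₗ[ℂ] N) (M : Submodule ℂ N) (r : ℕ) : Prop :=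
  (∀ x ∈ M, z x ∈ M) ∧
  ∃ b : Fin r → N,
    LinearIndependent ℂ (fun p : Fin r × ℤ => (z ^ p.2) (b p.1)) ∧
    Submodule.span ℂ (Set.range fun p : Fin r × ℤ => (z ^ p.2) (b p.1)) = ⊤ ∧
    Submodule.span ℂ (Set.range fun p : Fin r × ℕ => (z ^ (p.2 : ℤ)) (b p.1)) = M

/-- A V-lattice filtration on `N` (with jumps in `A + ℤ`, `A ⊆ [0,1)` finite):
(i) increasing; (ii) `z · V_β = V_{β+1}`; (iii) each `V_β` is stable under `z⁻¹` and
finitely generated over `ℂ[z⁻¹]`; (iv) the `ℂ[z,z⁻¹]`-span of each `V_β` is `N`;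
(v) `V_β = V_γ` if `(β,γ] ∩ (A + ℤ) = ∅`. -/
structure IsVLattice (z : N ≃ₗ[ℂ] N) (V : ℝ → Submodule ℂ N) (A : Finset ℝ) : Prop where
  mono : Monotone V
  map_z : ∀ β : ℝ, (V β).map z.toLinearMap = V (β + 1)
  zinv_stable : ∀ β : ℝ, ∀ x ∈ V β, z.symm x ∈ V β
  fg_zinv : ∀ β : ℝ, ∃ S : Finset N, (S : Set N) ⊆ (V β : Set N) ∧
    V β = Submodule.span ℂ {x : N | ∃ k : ℕ, ∃ s ∈ S, x = (z.symm ^ k) s}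
  span_laurent : ∀ β : ℝ, Submodule.span ℂ {x : N | ∃ k : ℤ, ∃ v ∈ V β, x = (z ^ k) v} = ⊤
  jumpsIn : ∀ a ∈ A, (0 : ℝ) ≤ a ∧ a < 1
  jumps : ∀ β γ : ℝ, β ≤ γ →
    (∀ a ∈ A, ∀ k : ℤ, ¬ (β < a + k ∧ a + k ≤ γ)) → V β = V γ

/-- `V_{<β} := ⋃_{γ < β} V_γ`. -/
def Vlt (V : ℝ → Submodule ℂ N) (β : ℝ) : Submodule ℂ N := ⨆ γ ∈ Set.Iio β, V γ

/-- The Harder–Narasimhan filtration of `N`: `F^HN_β(N)` is the `ℂ[z,z⁻¹]`-span of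
`V_β ∩ M`. -/
def FHN (z : N ≃ₗ[ℂ] N) (V : ℝ → Submodule ℂ N) (M : Submodule ℂ N) (β : ℝ) :
    Submodule ℂ N :=
  Submodule.span ℂ {x : N | ∃ k : ℤ, ∃ v ∈ V β ⊓ M, x = (z ^ k) v}

/-- Multiplication by `z ^ k` sends `V_β` into `V_{β+k}`, for every integer `k`. -/
theorem IsVLattice.zpow_mem {z : N ≃ₗ[ℂ] N} {V : ℝ → Submodule ℂ N} {A : Finset ℝ}
    (hV : IsVLattice z V A) (k : ℤ) {β : ℝ} {x : N} (hx : x ∈ V β) :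
    (z ^ k) x ∈ V (β + k) := by
  induction k with
  | zero => simpa using hx
  | succ n ih =>
    have h : z ((z ^ (n : ℤ)) x) ∈ V (β + (n : ℤ) + 1) := by
      rw [← hV.map_z]
      exact mem_map_of_mem ih
    rw [add_comm (n : ℤ) 1, zpow_one_add, LinearEquiv.mul_apply, add_comm 1 (n : ℤ)]
    rwa [Int.cast_add, Int.cast_one, ← add_assoc]
  | pred n ih =>
    have h : z.symm ((z ^ (-(n : ℤ))) x) ∈ V (β + (-(n : ℤ) - 1 : ℤ)) := by
      have e : β + ((-(n : ℤ) : ℤ) : ℝ) = β + (-(n : ℤ) - 1 : ℤ) + 1 := by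
        push_cast
        ring
      rw [e, ← hV.map_z] at ih
      obtain ⟨y, hy, hyx⟩ := ih
      rw [← hyx]
      simpa using hy
    rwa [sub_eq_neg_add, zpow_add, zpow_neg_one, ← sub_eq_neg_add]

/-- A submodule stable under `z` is stable under all nonnegative powers of `z`. -/
theorem zpow_mem_of_stable {z : N ≃ₗ[ℂ] N} {M : Submodule ℂ N} (hM : ∀ x ∈ M, z x ∈ M)
    {k : ℤ} (hk : 0 ≤ k) {x : N} (hx : x ∈ M) : (z ^ k) x ∈ M := by
  induction k, hk using Int.leInduction with
  | base => simpa using hx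
  | succ n _ ih =>
    rw [add_comm, zpow_one_add]
    exact hM _ ih

/-- Every element of `F^HN_β(N)` lies in `z ^ (-n) M + V_{β-n-1}`. This expresses the vanishing
of the first cohomology of a vector bundle on the projective line that is generically generated
by its global sections, after a twist by `-1`. -/
theorem FHN_le_map_sup {z : N ≃ₗ[ℂ] N} {M : Submodule ℂ N} {V : ℝ → Submodule ℂ N}
    {A : Finset ℝ} (hM : ∀ x ∈ M, z x ∈ M) (hV : IsVLattice z V A) (β : ℝ) (n : ℤ) :
    FHN z V M β ≤ M.map (z ^ (-n)).toLinearMap ⊔ V (β - n - 1) := by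
  refine span_le.mpr ?_
  rintro _ ⟨k, v, ⟨hvV, hvM⟩, rfl⟩
  rcases le_or_gt (-n) k with h | h
  · refine mem_sup_left ⟨(z ^ (n + k)) v, zpow_mem_of_stable hM (by lia) hvM, ?_⟩
    change (z ^ (-n) * z ^ (n + k)) v = _
    rw [← zpow_add, neg_add_cancel_left]
  · refine mem_sup_right (hV.mono ?_ (hV.zpow_mem k hvV))
    have : (k : ℝ) + 1 ≤ -n := by exact_mod_cast h
    linarith

/-- Lemma 3.2.6, first part: for `β - γ ∉ ℤ` one has
`F^HN_β(N) ∩ V_γ ⊆ F^HN_{<β}(N) + V_{<γ}`. -/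
theorem statement0 (z : N ≃ₗ[ℂ] N) (M : Submodule ℂ N) (r : ℕ)
    (V : ℝ → Submodule ℂ N) (A : Finset ℝ)
    (hM : IsFreeLattice z M r) (hV : IsVLattice z V A) :
    ∀ β γ : ℝ, (¬ ∃ k : ℤ, β - γ = (k : ℝ)) →
      FHN z V M β ⊓ V γ ≤ (⨆ β' ∈ Set.Iio β, FHN z V M β') ⊔ Vlt V γ := by
  rintro β γ hβγ x ⟨hxF, hxV⟩
  set n : ℤ := ⌊β - γ⌋
  have hn : γ + n < β := by
    have h : (n : ℝ) < β - γ := lt_of_le_of_ne (Int.floor_le _) fun h => hβγ ⟨n, h.symm⟩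
    linarith
  have hn' : β - n - 1 < γ := by linarith [Int.lt_floor_add_one (β - γ)]
  obtain ⟨_, ⟨m, hm, rfl⟩, v, hv, rfl⟩ := mem_sup.mp (FHN_le_map_sup hM.1 hV β n hxF)
  refine add_mem (mem_sup_left ?_) (mem_sup_right ?_)
  · have h : (z ^ (-n)) m ∈ V γ :=
      ((V γ).add_mem_iff_left (hV.mono hn'.le hv)).mp hxV
    have hmV : m ∈ V (γ + n) := by
      have := hV.zpow_mem n h
      rwa [← LinearEquiv.mul_apply, ← zpow_add, add_neg_cancel, zpow_zero] at this
    exact mem_iSup_of_mem (γ + n) <| mem_iSup_of_mem hn <|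
      subset_span ⟨-n, m, ⟨hmV, hm⟩, rfl⟩
  · exact mem_iSup_of_mem (β - n - 1) <| mem_iSup_of_mem hn' hv
end
end

section
/- There exists a ℂ-subspace E ⊆ M, of dimension r over ℂ, such that M = ⊕_{j≥0} z^j·E (an internal direct sum of ℂ-subspaces) and, for every γ ∈ ℝ, V_γ ∩ M = ⊕_{j≥0} z^j·(V_{γ−j} ∩ E). In other words, M admits a V-adapted trivializing subspace. (Proposition 3.2.8 of 'Irregular Hodge theory': existence of a V-adapted trivializing lattice.) -/
noncomputable section

open Submodule Set

variable {N : Type*} [AddCommGroup N] [Module ℂ N]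

/-- `T` is the internal direct sum of the family of subspaces `W`. -/
def IsInternalDirectSum {P : Type*} [AddCommGroup P] [Module ℂ P] {ι : Type*}
    (W : ι → Submodule ℂ P) (T : Submodule ℂ P) : Prop :=
  iSup W = T ∧ ∀ i : ι, W i ⊓ (⨆ (j : ι) (_ : j ≠ i), W j) = ⊥

/-- `E` is a V-adapted trivializing subspace for `M`:
`M = ⊕_{j ≥ 0} z^j·E` and `V_γ ∩ M = ⊕_{j ≥ 0} z^j·(V_{γ−j} ∩ E)` for every `γ`. -/
def IsVAdapted (z : N ≃ₗ[ℂ] N) (V : ℝ → Submodule ℂ N) (M E : Submodule ℂ N) : Prop :=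
  E ≤ M ∧
  IsInternalDirectSum (fun j : ℕ => E.map ((z ^ (j : ℤ)).toLinearMap)) M ∧
  ∀ γ : ℝ, IsInternalDirectSum
    (fun j : ℕ => ((V (γ - j) ⊓ E).map ((z ^ (j : ℤ)).toLinearMap))) (V γ ⊓ M)

/-- A monotone family of finite-dimensional subspaces of `X` can be lifted strictly along a linear
map to a finite-dimensional space: there is a subspace `E` on which `q` is injective and such that
every `q (G γ)` is the image of `E ⊓ G γ`. -/
theorem exists_strict_lift {K ι X Q : Type*} [DivisionRing K] [LinearOrder ι]
    [AddCommGroup X] [Module K X] [AddCommGroup Q] [Module K Q] [FiniteDimensional K Q]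
    (q : X →ₗ[K] Q) (G : ι → Submodule K X) (hG : Monotone G)
    (hfin : ∀ γ, FiniteDimensional K (G γ)) :
    ∃ E : Submodule K X, E ≤ ⨆ γ, G γ ∧ (∀ e ∈ E, q e = 0 → e = 0) ∧
      ∀ γ, ∀ x ∈ G γ, ∃ e ∈ E, e ∈ G γ ∧ q e = q x := by
  let S : Set (Submodule K X) := {E | E ≤ ⨆ γ, G γ ∧ (∀ e ∈ E, q e = 0 → e = 0) ∧
    ∀ γ, ∀ x ∈ G γ, q x ∈ E.map q → ∃ e ∈ E, e ∈ G γ ∧ q e = q x}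
  have hbot : (⊥ : Submodule K X) ∈ S := by
    refine ⟨bot_le, fun e he _ => by simpa using he, fun γ x _ hq => ⟨0, ?_⟩⟩
    simpa [eq_comm] using hq
  obtain ⟨T, ⟨E, ⟨hEG, hEq, hE⟩, rfl⟩, hmax⟩ :=
    (wellFounded_gt (α := Submodule K Q)).has_min ((fun E => E.map q) '' S) ⟨_, ⊥, hbot, rfl⟩
  refine ⟨E, hEG, hEq, fun γ x hx => hE γ x hx ?_⟩
  by_contra hxE
  obtain ⟨γ₀, ⟨m, hm, hmE⟩, hmin⟩ :=
    (measure fun δ => Module.finrank K (G δ)).wf.has_min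
      {δ | ∃ m ∈ G δ, q m ∉ E.map q} ⟨γ, x, hx, hxE⟩
  have key : ∀ δ, (∃ y ∈ G δ, q y ∉ E.map q) → m ∈ G δ := by
    intro δ hδ
    rcases le_total γ₀ δ with h | h
    · exact hG h hm
    · rwa [Submodule.eq_of_le_of_finrank_le (hG h) (not_lt.1 (hmin δ hδ))]
  have hmem : E ⊔ K ∙ m ∈ S := by
    refine ⟨sup_le hEG ?_, ?_, ?_⟩
    · rw [Submodule.span_singleton_le_iff_mem]
      exact Submodule.mem_iSup_of_mem γ₀ hm
    · intro e he hqe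
      obtain ⟨a, ha, b, hb, rfl⟩ := Submodule.mem_sup.1 he
      obtain ⟨c, rfl⟩ := Submodule.mem_span_singleton.1 hb
      have hc : c = 0 := by
        by_contra hc
        refine hmE ?_
        rw [← Submodule.smul_mem_iff _ hc, ← map_smul]
        rw [map_add] at hqe
        rw [eq_neg_of_add_eq_zero_right hqe]
        exact neg_mem (Submodule.mem_map_of_mem ha)
      simp only [hc, zero_smul, add_zero] at hqe ⊢
      exact hEq a ha hqe
    · rintro δ y hy ⟨e, he, hey⟩
      obtain ⟨a, ha, b, hb, rfl⟩ := Submodule.mem_sup.1 he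
      obtain ⟨c, rfl⟩ := Submodule.mem_span_singleton.1 hb
      by_cases hyE : q y ∈ E.map q
      · obtain ⟨e, he, h⟩ := hE δ y hy hyE
        exact ⟨e, Submodule.mem_sup_left he, h⟩
      · have hmδ := key δ ⟨y, hy, hyE⟩
        have hya : q a = q (y - c • m) := by rw [map_sub, ← hey, map_add, add_sub_cancel_right]
        obtain ⟨e, he, heδ, h⟩ := hE δ (y - c • m) (sub_mem hy (Submodule.smul_mem _ c hmδ))
          (hya ▸ Submodule.mem_map_of_mem ha)
        refine ⟨e + c • m, Submodule.add_mem_sup he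
          (Submodule.smul_mem _ c (Submodule.mem_span_singleton_self m)),
          add_mem heδ (Submodule.smul_mem _ c hmδ), ?_⟩
        rw [map_add, h, ← map_add, sub_add_cancel]
  refine hmax _ ⟨_, hmem, rfl⟩ (lt_of_le_of_ne (Submodule.map_mono le_sup_left) fun h => hmE ?_)
  change E.map q = (E ⊔ K ∙ m).map q at h
  rw [h]
  exact Submodule.mem_map_of_mem (Submodule.mem_sup_right (Submodule.mem_span_singleton_self m))

theorem pow_apply_mem {z : N ≃ₗ[ℂ] N} {M : Submodule ℂ N} (hzM : ∀ x ∈ M, z x ∈ M) (n : ℕ)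
    {x : N} (hx : x ∈ M) : (z ^ n) x ∈ M := by
  induction n with
  | zero => exact hx
  | succ n ih =>
    rw [pow_succ', LinearEquiv.mul_apply]
    exact hzM _ ih

/-- If `E ≤ M` meets `z M` trivially, the subspaces `z ^ j E` are independent. -/
theorem iSupIndep_map_zpow (z : N ≃ₗ[ℂ] N) {M E : Submodule ℂ N} (hzM : ∀ x ∈ M, z x ∈ M)
    (hEM : E ≤ M) (hE : ∀ e ∈ E, ∀ x ∈ M, e = z x → e = 0) :
    iSupIndep fun j : ℕ => E.map ((z ^ (j : ℤ)).toLinearMap) := by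
  rw [iSupIndep_iff_finsetSum_eq_zero_imp_eq_zero]
  intro s v hv hsum i
  induction i using Nat.strong_induction_on with
  | _ i ih =>
    intro hi
    have hrest : ∀ j ∈ s.erase i, v j ∈ M.map (z ^ (i + 1)).toLinearMap := by
      intro j hj
      obtain ⟨hji, hjs⟩ := Finset.mem_erase.1 hj
      rcases lt_or_gt_of_ne hji with h | h
      · rw [ih j h hjs]
        exact zero_mem _
      · obtain ⟨e, he, hej⟩ := hv j hjs
        refine ⟨(z ^ (j - (i + 1))) e, pow_apply_mem hzM _ (hEM he), ?_⟩
        rw [← hej]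
        change (z ^ (i + 1) * z ^ (j - (i + 1))) e = (z ^ (j : ℤ)) e
        rw [← pow_add, zpow_natCast, Nat.add_sub_cancel' h]
    obtain ⟨x, hx, hxi⟩ := neg_mem (Submodule.sum_mem _ hrest)
    obtain ⟨e, he, hei⟩ := hv i hi
    rw [← Finset.add_sum_erase s v hi] at hsum
    rw [← eq_neg_of_add_eq_zero_left hsum, ← hei] at hxi
    have hez : e = z x := by
      apply (z ^ i).injective
      rw [← LinearEquiv.mul_apply, ← pow_succ]
      simpa using hxi.symm
    rw [← hei, hE e he x hx hez, map_zero]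

theorem IsVLattice.map_mem_iff {z : N ≃ₗ[ℂ] N} {V : ℝ → Submodule ℂ N} {A : Finset ℝ}
    (hV : IsVLattice z V A) (β : ℝ) (x : N) : z x ∈ V (β + 1) ↔ x ∈ V β := by
  rw [← hV.map_z]
  exact z.injective.mem_set_image

theorem IsVLattice.pow_mem_iff {z : N ≃ₗ[ℂ] N} {V : ℝ → Submodule ℂ N} {A : Finset ℝ}
    (hV : IsVLattice z V A) (n : ℕ) (β : ℝ) (x : N) : (z ^ n) x ∈ V (β + n) ↔ x ∈ V β := by
  induction n with
  | zero => simp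
  | succ n ih =>
    rw [pow_succ', LinearEquiv.mul_apply, Nat.cast_succ, ← add_assoc, hV.map_mem_iff, ih]

theorem IsVLattice.exists_mem {z : N ≃ₗ[ℂ] N} {V : ℝ → Submodule ℂ N} {A : Finset ℝ}
    (hV : IsVLattice z V A) (x : N) : ∃ β, x ∈ V β := by
  rw [← Submodule.mem_iSup_of_directed V hV.mono.directed_le]
  suffices (⨆ β, V β) = ⊤ from this ▸ Submodule.mem_top
  rw [eq_top_iff, ← hV.span_laurent 0, Submodule.span_le]
  rintro _ ⟨k, v, hv, rfl⟩
  obtain ⟨n, rfl | rfl⟩ := k.eq_nat_or_neg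
  · refine Submodule.mem_iSup_of_mem (0 + n : ℝ) ?_
    rwa [zpow_natCast, hV.pow_mem_iff]
  · refine Submodule.mem_iSup_of_mem (-n : ℝ) ?_
    rw [← hV.pow_mem_iff n, zpow_neg, zpow_natCast, ← LinearEquiv.mul_apply, mul_inv_cancel]
    simpa using hv

/-- Coordinates on `N` adapted to a free lattice `M`: `c i k x` is the coefficient of `x` on
`z ^ k (b i)`. -/
theorem IsFreeLattice.exists_coord {z : N ≃ₗ[ℂ] N} {M : Submodule ℂ N} {r : ℕ}
    (hM : IsFreeLattice z M r) :
    ∃ (b : Fin r → N) (c : Fin r → ℤ → N →ₗ[ℂ] ℂ),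
      (∀ i, b i ∈ M) ∧ (∀ i j, c i 0 (b j) = if j = i then 1 else 0) ∧
      (∀ i k x, c i k (z x) = c i (k - 1) x) ∧
      (∀ x, (∀ i k, c i k x = 0) → x = 0) ∧
      (∀ x, ∃ K : ℤ, ∀ i k, K ≤ k → c i k x = 0) ∧
      (∀ x ∈ M, ∀ i k, k < 0 → c i k x = 0) ∧
      (∀ x ∈ M, (∀ i, c i 0 x = 0) → ∃ y ∈ M, x = z y) := by
  obtain ⟨hzM, b, hli, hsp, hspM⟩ := hM
  let B : Module.Basis (Fin r × ℤ) ℂ N := Module.Basis.mk hli hsp.ge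
  have hB : ∀ p, B p = (z ^ p.2) (b p.1) := Module.Basis.mk_apply hli hsp.ge
  have hBc : ∀ (p : Fin r × ℤ) (n : ℤ) (j), B.coord p ((z ^ n) (b j)) =
      if (j, n) = p then 1 else 0 := by
    intro p n j
    rw [← hB (j, n), Module.Basis.coord_apply, Module.Basis.repr_self, Finsupp.single_apply]
  have hbM : ∀ i, ∀ n : ℕ, (z ^ (n : ℤ)) (b i) ∈ M := fun i n =>
    hspM ▸ Submodule.subset_span ⟨(i, n), rfl⟩
  refine ⟨b, fun i k => B.coord (i, k), fun i => by simpa using hbM i 0, ?_, ?_, ?_, ?_, ?_, ?_⟩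
  · intro i j
    simpa using hBc (i, 0) 0 j
  · intro i k x
    suffices B.coord (i, k) ∘ₗ z.toLinearMap = B.coord (i, k - 1) from LinearMap.congr_fun this x
    refine B.ext fun p => ?_
    rw [hB, LinearMap.comp_apply, LinearEquiv.coe_coe, ← LinearEquiv.mul_apply, ← zpow_one_add,
      hBc, hBc]
    congr 1
    simp only [Prod.mk.injEq, eq_iff_iff]
    constructor <;> rintro ⟨h, h'⟩ <;> exact ⟨h, by lia⟩
  · intro x hx
    exact B.forall_coord_eq_zero_iff.1 fun p => hx p.1 p.2
  · intro x
    obtain ⟨K, hK⟩ := ((B.repr x).support.image Prod.snd).bddAbove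
    refine ⟨K + 1, fun i k hk => ?_⟩
    by_contra h
    have := hK (Finset.mem_coe.2 (Finset.mem_image_of_mem Prod.snd (Finsupp.mem_support_iff.2 h)))
    exact absurd (this : k ≤ K) (by lia)
  · intro x hx i k hk
    suffices M ≤ LinearMap.ker (B.coord (i, k)) from this hx
    rw [← hspM, Submodule.span_le]
    rintro _ ⟨p, rfl⟩
    rw [SetLike.mem_coe, LinearMap.mem_ker, hBc, if_neg]
    rintro h
    have := congrArg Prod.snd h
    simp only at this
    lia
  · intro x hx h0
    suffices M ≤ (M.map z.toLinearMap).comap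
        (LinearMap.id - ∑ i, (B.coord (i, 0)).smulRight (b i)) by
      obtain ⟨y, hy, h⟩ := this hx
      refine ⟨y, hy, ?_⟩
      simpa [-Module.Basis.coord_apply, h0, LinearMap.sum_apply] using h.symm
    conv_lhs => rw [← hspM]
    rw [Submodule.span_le]
    rintro _ ⟨⟨j, n⟩, rfl⟩
    simp only [SetLike.mem_coe, Submodule.mem_comap, LinearMap.sub_apply, LinearMap.id_apply,
      LinearMap.sum_apply, LinearMap.smulRight_apply, hBc]
    cases n with
    | zero => simp
    | succ n =>
      refine ⟨(z ^ (n : ℤ)) (b j), hbM j n, ?_⟩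
      have : ∀ i, ¬ ((j, ((n + 1 : ℕ) : ℤ)) = (i, 0)) := by
        intro i h
        have := congrArg Prod.snd h
        simp only at this
        lia
      simp only [this, if_false, zero_smul, Finset.sum_const_zero, sub_zero]
      rw [LinearEquiv.coe_coe, ← LinearEquiv.mul_apply, ← zpow_one_add, Nat.cast_succ, add_comm]

/-- Proposition 3.2.8: existence of a V-adapted trivializing subspace `E ⊆ M`
of dimension `r` over `ℂ`. -/
theorem statement3 (z : N ≃ₗ[ℂ] N) (M : Submodule ℂ N) (r : ℕ)
    (V : ℝ → Submodule ℂ N) (A : Finset ℝ)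
    (hM : IsFreeLattice z M r) (hV : IsVLattice z V A) :
    ∃ E : Submodule ℂ N, FiniteDimensional ℂ E ∧ Module.finrank ℂ E = r ∧
      IsVAdapted z V M E := by
  obtain ⟨b, c, hbM, hcb, hcz, hc0, hcK, hcM, hcker⟩ := hM.exists_coord
  have hzM := hM.1
  -- the degree of the elements of each `V β` is bounded above
  have hVK : ∀ β, ∃ K : ℤ, ∀ x ∈ V β, ∀ i k, K ≤ k → c i k x = 0 := by
    intro β
    obtain ⟨S, -, hS⟩ := hV.fg_zinv β
    choose K hK using hcK
    obtain ⟨K', hK'⟩ := (S.image K).bddAbove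
    have hcsymm : ∀ (n : ℕ) i k x, c i k ((z.symm ^ n) x) = c i (k + n) x := by
      intro n i
      induction n with
      | zero => simp
      | succ n ih =>
        intro k x
        have := hcz i (k + 1) (z.symm ((z.symm ^ n) x))
        rw [LinearEquiv.apply_symm_apply, add_sub_cancel_right] at this
        rw [pow_succ', LinearEquiv.mul_apply, ← this, ih]
        rw [Nat.cast_succ, add_assoc, add_comm 1 (n : ℤ)]
    refine ⟨K', fun x hx i k hk => ?_⟩
    suffices V β ≤ LinearMap.ker (c i k) from this hx
    rw [hS, Submodule.span_le]
    rintro _ ⟨n, s, hs, rfl⟩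
    rw [SetLike.mem_coe, LinearMap.mem_ker, hcsymm]
    have : K s ≤ K' := hK' (Finset.mem_coe.2 (Finset.mem_image_of_mem K hs))
    exact hK s _ _ (by lia)
  let q : N →ₗ[ℂ] (Fin r → ℂ) := LinearMap.pi fun i => c i 0
  let G : ℝ → Submodule ℂ N := fun γ => V γ ⊓ M
  have hGmono : Monotone G := fun β γ h => inf_le_inf_right M (hV.mono h)
  have hGfin : ∀ γ, FiniteDimensional ℂ (G γ) := by
    intro γ
    obtain ⟨K, hK⟩ := hVK γ
    let f : G γ →ₗ[ℂ] (Fin r × Fin K.toNat → ℂ) :=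
      LinearMap.pi fun p => c p.1 (p.2 : ℕ) ∘ₗ (G γ).subtype
    refine FiniteDimensional.of_injective f ?_
    rw [injective_iff_map_eq_zero]
    rintro ⟨x, hx⟩ hfx
    refine Subtype.ext (hc0 x fun i k => ?_)
    rcases lt_or_ge k 0 with h | h
    · exact hcM x hx.2 i k h
    rcases le_or_gt K k with h' | h'
    · exact hK x hx.1 i k h'
    · lift k to ℕ using h
      exact congrFun hfx (i, ⟨k, by lia⟩)
  have hGM : (⨆ γ, G γ) = M := by
    refine le_antisymm (iSup_le fun γ => inf_le_right) fun x hx => ?_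
    obtain ⟨β, hβ⟩ := hV.exists_mem x
    exact Submodule.mem_iSup_of_mem β ⟨hβ, hx⟩
  obtain ⟨E, hEG, hEq, hE⟩ := exists_strict_lift q G hGmono hGfin
  have hEM : E ≤ M := hGM ▸ hEG
  have hqz : ∀ x ∈ M, q (z x) = 0 := fun x hx => funext fun i => by
    simpa [q, hcz] using hcM x hx i (-1) (by lia)
  have hEz : ∀ e ∈ E, ∀ x ∈ M, e = z x → e = 0 := fun e he x hx h =>
    hEq e he (h ▸ hqz x hx)
  -- `q` restricts to an isomorphism of `E` onto `Fin r → ℂ`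
  have hbij : Function.Bijective (q.domRestrict E) := by
    constructor
    · rw [injective_iff_map_eq_zero]
      exact fun e he => Subtype.ext (hEq e e.2 he)
    · intro w
      obtain ⟨β, hβ⟩ := hV.exists_mem (∑ i, w i • b i)
      obtain ⟨e, he, -, h⟩ := hE β _
        ⟨hβ, Submodule.sum_mem _ fun i _ => Submodule.smul_mem _ _ (hbM i)⟩
      refine ⟨⟨e, he⟩, h.trans (funext fun i => ?_)⟩
      simp [q, hcb]
  let φ : E ≃ₗ[ℂ] (Fin r → ℂ) := LinearEquiv.ofBijective _ hbij
  have hind := iSupIndep_map_zpow z hzM hEM hEz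
  let U : ℝ → Submodule ℂ N :=
    fun γ => ⨆ j : ℕ, (V (γ - j) ⊓ E).map ((z ^ (j : ℤ)).toLinearMap)
  have hzU : ∀ γ, ∀ x ∈ U (γ - 1), z x ∈ U γ := by
    intro γ
    change U (γ - 1) ≤ (U γ).comap z.toLinearMap
    refine iSup_le fun j => ?_
    rintro _ ⟨e, he, rfl⟩
    refine Submodule.mem_iSup_of_mem (j + 1) ⟨e, ⟨?_, he.2⟩, ?_⟩
    · rw [show γ - ((j + 1 : ℕ) : ℝ) = γ - 1 - j by push_cast; ring]
      exact he.1
    · rw [Nat.cast_succ, add_comm, zpow_one_add]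
      rfl
  have hczn : ∀ (n : ℕ) i k x, c i k ((z ^ n) x) = c i (k - n) x := by
    intro n i
    induction n with
    | zero => simp
    | succ n ih =>
      intro k x
      rw [pow_succ', LinearEquiv.mul_apply, hcz, ih]
      rw [Nat.cast_succ, sub_sub, add_comm 1 (n : ℤ)]
  obtain ⟨K, hK⟩ := hVK 0
  have hbot : ∀ γ, γ ≤ -(K.toNat : ℝ) → ∀ x ∈ G γ, x = 0 := by
    intro γ hγ x hx
    refine hc0 x fun i k => ?_
    rcases lt_or_ge k 0 with h | h
    · exact hcM x hx.2 i k h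
    · have hx0 : (z ^ K.toNat) x ∈ V 0 := by
        have := (hV.pow_mem_iff K.toNat _ x).2 (hV.mono hγ hx.1)
        rwa [neg_add_cancel] at this
      have := hK _ hx0 i (k + K.toNat) (by lia)
      rwa [hczn, add_sub_cancel_right] at this
  have hle : ∀ (n : ℕ) γ, γ ≤ -(K.toNat : ℝ) + n → G γ ≤ U γ := by
    intro n
    induction n with
    | zero =>
      intro γ hγ x hx
      rw [hbot γ (by simpa using hγ) x hx]
      exact zero_mem _
    | succ n ih =>
      intro γ hγ x hx
      obtain ⟨e, he, heG, hex⟩ := hE γ x hx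
      obtain ⟨y, hy, hxy⟩ := hcker (x - e) (sub_mem hx.2 heG.2) fun i => by
        have := congrFun hex i
        rw [map_sub, sub_eq_zero]
        exact this.symm
      have hyV : y ∈ V (γ - 1) := by
        rw [← hV.map_mem_iff, ← hxy, sub_add_cancel]
        exact sub_mem hx.1 heG.1
      rw [← sub_add_cancel x e, hxy]
      refine add_mem (hzU γ y (ih _ ?_ ⟨hyV, hy⟩)) ?_
      · push_cast at hγ
        linarith
      · exact Submodule.mem_iSup_of_mem 0 ⟨e, ⟨by simpa using heG.1, he⟩, by simp⟩
  have hGU : ∀ γ, G γ ≤ U γ := by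
    intro γ
    obtain ⟨n, hn⟩ := exists_nat_ge (γ + K.toNat)
    exact hle n γ (by linarith)
  refine ⟨E, φ.symm.finiteDimensional, by rw [φ.finrank_eq, Module.finrank_fin_fun], hEM,
    ⟨le_antisymm (iSup_le fun j => ?_) ?_, fun i => (hind i).eq_bot⟩, fun γ =>
    ⟨le_antisymm (iSup_le fun j => ?_) (hGU γ), fun i => ?_⟩⟩
  · rintro _ ⟨e, he, rfl⟩
    simpa using pow_apply_mem hzM j (hEM he)
  · rw [← hGM]
    exact iSup_le fun γ => (hGU γ).trans
      (iSup_mono fun j => Submodule.map_mono inf_le_right)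
  · rintro _ ⟨e, he, rfl⟩
    refine ⟨?_, by simpa using pow_apply_mem hzM j (hEM he.2)⟩
    have := (hV.pow_mem_iff j _ e).2 he.1
    rwa [sub_add_cancel] at this
  · have hindV : iSupIndep fun j : ℕ => (V (γ - j) ⊓ E).map ((z ^ (j : ℤ)).toLinearMap) :=
      hind.mono fun j => Submodule.map_mono inf_le_right
    exact (hindV i).eq_bot
end
end

section
/- Let E ⊆ M be a V-adapted trivializing subspace. Then for every γ ∈ ℝ one has V_γ = ⊕_{k∈ℤ} z^k·(V_{γ−k} ∩ E), an internal direct sum of ℂ-subspaces of N. (Formula (eq:Vbeta) in Section 3.2.2 of 'Irregular Hodge theory'.) -/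
noncomputable section

open Submodule Set

variable {N : Type*} [AddCommGroup N] [Module ℂ N]

open Filter in
/-- Every element of `N` is moved into the lattice `M` by all large powers of `z`. -/
theorem IsFreeLattice.eventually_zpow_mem {z : N ≃ₗ[ℂ] N} {M : Submodule ℂ N} {r : ℕ}
    (hM : IsFreeLattice z M r) (x : N) :
    ∀ᶠ n : ℕ in atTop, (z ^ (n : ℤ)) x ∈ M := by
  obtain ⟨-, b, -, htop, hspan⟩ := hM
  have hx : x ∈ span ℂ (Set.range fun p : Fin r × ℤ => (z ^ p.2) (b p.1)) :=
    htop ▸ mem_top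
  induction hx using Submodule.span_induction with
  | mem x hx =>
    obtain ⟨⟨i, k⟩, rfl⟩ := hx
    filter_upwards [eventually_ge_atTop (-k).toNat] with n hn
    rw [← hspan]
    refine subset_span ⟨(i, (n + k).toNat), ?_⟩
    have h : (((n + k).toNat : ℕ) : ℤ) = n + k := by omega
    simp only [h, zpow_add, LinearEquiv.mul_apply]
  | zero => simp
  | add x y _ _ hx hy =>
    filter_upwards [hx, hy] with n h1 h2
    rw [map_add]
    exact M.add_mem h1 h2
  | smul c x _ hx =>
    filter_upwards [hx] with n h
    rw [map_smul]
    exact M.smul_mem c h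

open Filter in
/-- If the translates `z ^ j · E`, `j ∈ ℕ`, form a direct sum, then so do the translates
`z ^ k · E`, `k ∈ ℤ`. -/
theorem zpow_map_inf_iSup_eq_bot {z : N ≃ₗ[ℂ] N} {E : Submodule ℂ N}
    (h : ∀ i : ℕ, E.map (z ^ (i : ℤ)).toLinearMap ⊓
      (⨆ (j : ℕ) (_ : j ≠ i), E.map (z ^ (j : ℤ)).toLinearMap) = ⊥) (i : ℤ) :
    E.map (z ^ i).toLinearMap ⊓
      (⨆ (j : ℤ) (_ : j ≠ i), E.map (z ^ j).toLinearMap) = ⊥ := by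
  rw [eq_bot_iff]
  rintro x ⟨⟨e, he, rfl⟩, hx⟩
  have key : ∀ y ∈ (⨆ (j : ℤ) (_ : j ≠ i), E.map (z ^ j).toLinearMap),
      ∀ᶠ n : ℕ in atTop, (z ^ (n : ℤ)) y ∈
        ⨆ (j : ℕ) (_ : j ≠ (n + i).toNat), E.map (z ^ (j : ℤ)).toLinearMap := by
    intro y hy
    rw [iSup_subtype'] at hy
    induction hy using Submodule.iSup_induction' with
    | mem j y hy =>
      obtain ⟨f, hf, rfl⟩ := hy
      filter_upwards [eventually_ge_atTop (-j.1).toNat, eventually_ge_atTop (-i).toNat]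
        with n hn hn'
      have hj := j.2
      have hne : (n + j.1).toNat ≠ (n + i).toNat := by omega
      refine mem_iSup_of_mem (n + j.1).toNat (mem_iSup_of_mem hne ⟨f, hf, ?_⟩)
      have hc : (((n + j.1).toNat : ℕ) : ℤ) = n + j.1 := by omega
      simp only [hc, zpow_add, LinearEquiv.coe_coe, LinearEquiv.mul_apply]
    | zero => simp
    | add x y _ _ hx hy =>
      filter_upwards [hx, hy] with n h1 h2
      rw [map_add]
      exact add_mem h1 h2
  obtain ⟨n, hn, hni⟩ := ((key _ hx).and (eventually_ge_atTop (-i).toNat)).exists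
  have hc : (((n + i).toNat : ℕ) : ℤ) = n + i := by omega
  have hmem : (z ^ (n : ℤ)) ((z ^ i).toLinearMap e) ∈
      E.map (z ^ (((n + i).toNat : ℕ) : ℤ)).toLinearMap := by
    refine ⟨e, he, ?_⟩
    simp only [hc, zpow_add, LinearEquiv.coe_coe, LinearEquiv.mul_apply]
  have h0 := (h (n + i).toNat).le ⟨hmem, hn⟩
  rw [Submodule.mem_bot] at h0 ⊢
  exact (LinearEquiv.map_eq_zero_iff _).mp h0

/-- Formula (eq:Vbeta): for a V-adapted trivializing subspace `E`,
`V_γ = ⊕_{k ∈ ℤ} z^k·(V_{γ−k} ∩ E)` for every `γ ∈ ℝ`. -/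
theorem statement4 (z : N ≃ₗ[ℂ] N) (M : Submodule ℂ N) (r : ℕ)
    (V : ℝ → Submodule ℂ N) (A : Finset ℝ) (E : Submodule ℂ N)
    (hM : IsFreeLattice z M r) (hV : IsVLattice z V A)
    (hE : IsVAdapted z V M E) :
    ∀ γ : ℝ, IsInternalDirectSum
      (fun k : ℤ => ((V (γ - k) ⊓ E).map ((z ^ k).toLinearMap))) (V γ) := by
  intro γ
  refine ⟨le_antisymm (iSup_le fun k => ?_) fun x hx => ?_, fun i => ?_⟩
  · rintro _ ⟨e, ⟨he, -⟩, rfl⟩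
    simpa using hV.zpow_mem k he
  · obtain ⟨n, hn⟩ := (hM.eventually_zpow_mem x).exists
    have hx' : (z ^ (n : ℤ)) x ∈ V (γ + n) ⊓ M :=
      ⟨by simpa using hV.zpow_mem n hx, hn⟩
    rw [← (hE.2.2 (γ + n)).1] at hx'
    have hle : (⨆ j : ℕ, (V (γ + n - j) ⊓ E).map (z ^ (j : ℤ)).toLinearMap) ≤
        (⨆ k : ℤ, (V (γ - k) ⊓ E).map (z ^ k).toLinearMap).comap
          (z ^ (-(n : ℤ))).toLinearMap := by
      refine iSup_le fun j => ?_
      rintro _ ⟨e, ⟨heV, heE⟩, rfl⟩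
      refine mem_iSup_of_mem (-(n : ℤ) + j) ⟨e, ⟨?_, heE⟩, ?_⟩
      · convert heV using 2
        push_cast
        ring_nf
      · simp only [zpow_add, LinearEquiv.coe_coe, LinearEquiv.mul_apply]
    have hxn : (z ^ (-(n : ℤ))) ((z ^ (n : ℤ)) x) = x := by
      rw [← LinearEquiv.mul_apply, ← zpow_add]
      simp
    have hmem := hle hx'
    rw [mem_comap, LinearEquiv.coe_coe, hxn] at hmem
    exact hmem
  · rw [eq_bot_iff, ← zpow_map_inf_iSup_eq_bot hE.2.1.2 i]
    exact inf_le_inf (map_mono inf_le_right)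
      (iSup₂_mono fun j _ => map_mono inf_le_right)
end
end

section
/- Let E ⊆ M be a V-adapted trivializing subspace and let π : M → H := M/(z−1)M be the projection. Then the restriction of π to E is a ℂ-linear isomorphism E ≅ H, and for every β ∈ ℝ one has π(V_β ∩ M) = π(V_β ∩ E). Consequently, under the isomorphism E ≅ H, the irregular Hodge filtration F^irr_β H := π(V_β ∩ M) is identified with V_β ∩ E. (Lemma 3.2.10 of 'Irregular Hodge theory'.) -/
noncomputable section

open Submodule Set

variable {N : Type*} [AddCommGroup N] [Module ℂ N]

/-- If the sum of the `W j` is internal, a vanishing finite sum of elements of distinct `W j` has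
all its terms zero. -/
theorem IsInternalDirectSum.eq_zero_of_sum_eq_zero {P : Type*} [AddCommGroup P] [Module ℂ P]
    {ι : Type*} {W : ι → Submodule ℂ P} {T : Submodule ℂ P} (h : IsInternalDirectSum W T)
    (s : Finset ι) (g : ι → P) (hg : ∀ i ∈ s, g i ∈ W i) (hsum : ∑ i ∈ s, g i = 0) :
    ∀ i ∈ s, g i = 0 := by
  classical
  intro i hi
  have hmem : g i ∈ W i ⊓ (⨆ (j : ι) (_ : j ≠ i), W j) := by
    refine ⟨hg i hi, ?_⟩
    rw [← Finset.add_sum_erase s g hi] at hsum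
    rw [eq_neg_of_add_eq_zero_left hsum]
    refine neg_mem (Submodule.sum_mem _ fun j hj => ?_)
    exact Submodule.mem_iSup_of_mem j (Submodule.mem_iSup_of_mem (Finset.ne_of_mem_erase hj)
      (hg j (Finset.mem_of_mem_erase hj)))
  rw [h.2 i] at hmem
  exact (Submodule.mem_bot ℂ).1 hmem

theorem zpow_natCast_succ_apply (z : N ≃ₗ[ℂ] N) (j : ℕ) (x : N) :
    (z ^ ((j + 1 : ℕ) : ℤ)) x = z ((z ^ (j : ℤ)) x) := by
  rw [zpow_natCast, zpow_natCast, pow_succ', LinearEquiv.mul_apply]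

theorem zpow_natCast_sub_mem (z : N ≃ₗ[ℂ] N) {M : Submodule ℂ N} (hz : ∀ x ∈ M, z x ∈ M)
    {e : N} (he : e ∈ M) (j : ℕ) :
    (z ^ (j : ℤ)) e ∈ M ∧
      (z ^ (j : ℤ)) e - e ∈ M.map (z.toLinearMap - LinearMap.id) := by
  induction j with
  | zero => simpa using he
  | succ j ih =>
    rw [zpow_natCast_succ_apply]
    refine ⟨hz _ ih.1, ?_⟩
    have h : z ((z ^ (j : ℤ)) e) - (z ^ (j : ℤ)) e ∈ M.map (z.toLinearMap - LinearMap.id) :=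
      ⟨_, ih.1, by simp⟩
    simpa using add_mem h ih.2

theorem map_zpow_natCast_le_sup (z : N ≃ₗ[ℂ] N) {M F G : Submodule ℂ N}
    (hz : ∀ x ∈ M, z x ∈ M) (hF : F ≤ M) (hFG : F ≤ G) (j : ℕ) :
    F.map ((z ^ (j : ℤ)).toLinearMap) ≤ G ⊔ M.map (z.toLinearMap - LinearMap.id) := by
  rintro _ ⟨e, he, rfl⟩
  have h := Submodule.add_mem_sup (hFG he) (zpow_natCast_sub_mem z hz (hF he) j).2
  simpa using h

theorem inf_map_sub_id_eq_bot (z : N ≃ₗ[ℂ] N) {M E : Submodule ℂ N}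
    (h : IsInternalDirectSum (fun j : ℕ => E.map ((z ^ (j : ℤ)).toLinearMap)) M) :
    E ⊓ M.map (z.toLinearMap - LinearMap.id) = ⊥ := by
  rw [eq_bot_iff]
  rintro x ⟨hxE, m, hm, hmx⟩
  replace hmx : z m - m = x := by simpa using hmx
  rw [← h.1] at hm
  obtain ⟨f, hf, hfm⟩ := (Submodule.mem_iSup_iff_exists_finsupp _ _).1 hm
  obtain ⟨n, hn⟩ := f.support.exists_nat_subset_range
  have hf_n : f n = 0 := by
    by_contra hne
    exact Finset.notMem_range_self (hn (Finsupp.mem_support_iff.2 hne))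
  have hsum : ∑ j ∈ Finset.range n, f j = m := by
    rw [← hfm, Finsupp.sum_of_support_subset f hn _ (fun _ _ => rfl)]
  let g : ℕ → N := fun j => Nat.casesOn j (-f 0 - x) (fun i => z (f i) - f (i + 1))
  have hg : ∀ j ∈ Finset.range (n + 1), g j ∈ E.map ((z ^ (j : ℤ)).toLinearMap) := by
    rintro (_ | j) -
    · refine sub_mem (neg_mem (hf 0)) ⟨x, hxE, by simp⟩
    · refine sub_mem ?_ (hf (j + 1))
      obtain ⟨e, he, hej⟩ := hf j
      exact ⟨e, he, by
        rw [← hej]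
        exact zpow_natCast_succ_apply z j e⟩
  have hgsum : ∑ j ∈ Finset.range (n + 1), g j = 0 := by
    have hshift : ∑ j ∈ Finset.range n, f (j + 1) + f 0 = m := by
      rw [← Finset.sum_range_succ', Finset.sum_range_succ, hf_n, add_zero, hsum]
    have hz : ∑ j ∈ Finset.range n, z (f j) = z m := by rw [← hsum, map_sum]
    rw [Finset.sum_range_succ']
    change ∑ j ∈ Finset.range n, (z (f j) - f (j + 1)) + (-f 0 - x) = 0
    rw [Finset.sum_sub_distrib, hz, ← hmx, eq_sub_of_add_eq hshift]
    abel
  have hzero := h.eq_zero_of_sum_eq_zero _ g hg hgsum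
  have hpow : ∀ j ≤ n, f j = (z ^ (j : ℤ)) (-x) := by
    intro j
    induction j with
    | zero =>
      intro _
      have h0 : -f 0 - x = 0 := hzero 0 (by simp)
      simpa [neg_eq_iff_eq_neg] using sub_eq_zero.1 h0
    | succ j ih =>
      intro hj
      have hs : z (f j) - f (j + 1) = 0 := hzero (j + 1) (by simpa using hj)
      rw [zpow_natCast_succ_apply, ← ih (by omega), sub_eq_zero.1 hs]
  have hx := hpow n le_rfl
  rw [hf_n, eq_comm, LinearEquiv.map_eq_zero_iff, neg_eq_zero] at hx
  exact hx

/-- Lemma 3.2.10: for a V-adapted trivializing subspace `E`, the projection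
`π : M → H := M/(z−1)M` restricts to an isomorphism `E ≅ H` — equivalently,
`E ∩ (z−1)M = 0` and `E + (z−1)M = M` — and for every `β` one has
`π(V_β ∩ M) = π(V_β ∩ E)`, i.e. `(V_β ∩ M) + (z−1)M = (V_β ∩ E) + (z−1)M`;
so under `E ≅ H` the irregular Hodge filtration `F^irr_β H = π(V_β ∩ M)` is
identified with `V_β ∩ E`. -/
theorem statement5 (z : N ≃ₗ[ℂ] N) (M : Submodule ℂ N) (r : ℕ)
    (V : ℝ → Submodule ℂ N) (A : Finset ℝ) (E : Submodule ℂ N)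
    (hM : IsFreeLattice z M r) (hV : IsVLattice z V A)
    (hE : IsVAdapted z V M E) :
    E ⊓ M.map (z.toLinearMap - LinearMap.id) = ⊥ ∧
    E ⊔ M.map (z.toLinearMap - LinearMap.id) = M ∧
    ∀ β : ℝ,
      (V β ⊓ M) ⊔ M.map (z.toLinearMap - LinearMap.id) =
        (V β ⊓ E) ⊔ M.map (z.toLinearMap - LinearMap.id) := by
  obtain ⟨hz, -⟩ := hM
  obtain ⟨hEM, hsum, hVsum⟩ := hE
  have hmap : M.map (z.toLinearMap - LinearMap.id) ≤ M := by
    rintro _ ⟨m, hm, rfl⟩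
    exact sub_mem (hz m hm) hm
  refine ⟨inf_map_sub_id_eq_bot z hsum, le_antisymm (sup_le hEM hmap) ?_, fun β =>
    le_antisymm (sup_le ?_ le_sup_right) (sup_le_sup_right (inf_le_inf_left _ hEM) _)⟩
  · conv_lhs => rw [← hsum.1]
    exact iSup_le fun j => map_zpow_natCast_le_sup z hz hEM le_rfl j
  · rw [← (hVsum β).1]
    exact iSup_le fun j => map_zpow_natCast_le_sup z hz (inf_le_right.trans hEM)
      (inf_le_inf_right _ (hV.mono (by simp))) j
end
end

section
/- The convolution filtration U_γ := Σ_{γ₁+γ₂=γ} (ℂ-span of {x₁⊗x₂ : x₁ ∈ V¹_{γ₁}, x₂ ∈ V²_{γ₂}}) ⊆ N is a V-lattice filtration on N compatible with ∇; precisely: (a) U_β ⊆ U_γ for β ≤ γ and z·U_γ = U_{γ+1}; (b) each U_γ is stable under multiplication by z⁻¹ and finitely generated over ℂ[z⁻¹]; (c) the ℂ[z,z⁻¹]-span of each U_γ is N; (d) U_β = U_γ whenever β ≤ γ and (β,γ] contains no element of (A₁+A₂)+ℤ; (e) ∇(U_γ) ⊆ U_γ for every γ; (f) (∇ + γ·id)^{ν₁+ν₂}(U_γ)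 ⊆ U_{<γ} := ⋃_{δ<γ} U_δ for every γ ∈ ℝ. (The Claim in the proof of Proposition 3.2.13 of 'Irregular Hodge theory': the convolution filtration is the V-filtration of the tensor product.) -/
noncomputable section

open Submodule Set LaurentPolynomial

open scoped TensorProduct

/-- The ring `ℂ[z,z⁻¹]` of Laurent polynomials. -/
abbrev L : Type := LaurentPolynomial ℂ

variable {N : Type*} [AddCommGroup N] [Module ℂ N]

/-- Multiplication by `z` (the Laurent variable `T 1`) as a `ℂ`-linear automorphism of a
`ℂ[z,z⁻¹]`-module. -/
def zmul (N : Type*) [AddCommGroup N] [Module L N] [Module ℂ N] [IsScalarTower ℂ L N] :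
    N ≃ₗ[ℂ] N where
  toFun x := (T 1 : L) • x
  invFun x := (T (-1) : L) • x
  map_add' x y := smul_add _ x y
  map_smul' c x := smul_comm (T 1 : L) c x
  left_inv x := by show (T (-1) : L) • (T 1 : L) • x = x; rw [smul_smul, ← T_add]; simp
  right_inv x := by show (T 1 : L) • (T (-1) : L) • x = x; rw [smul_smul, ← T_add]; simp

variable {N₁ N₂ : Type*}
  [AddCommGroup N₁] [Module L N₁] [Module ℂ N₁] [IsScalarTower ℂ L N₁]
  [AddCommGroup N₂] [Module L N₂] [Module ℂ N₂] [IsScalarTower ℂ L N₂]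

/-- The convolution filtration
`U_γ := Σ_{γ₁+γ₂=γ} (ℂ-span of {x₁ ⊗ x₂ : x₁ ∈ V¹_{γ₁}, x₂ ∈ V²_{γ₂}})` on
`N = N₁ ⊗_{ℂ[z,z⁻¹]} N₂`. -/
def conv (V₁ : ℝ → Submodule ℂ N₁) (V₂ : ℝ → Submodule ℂ N₂) (γ : ℝ) :
    Submodule ℂ (N₁ ⊗[L] N₂) :=
  ⨆ (p : ℝ × ℝ) (_ : p.1 + p.2 = γ),
    Submodule.span ℂ {x : N₁ ⊗[L] N₂ | ∃ a ∈ V₁ p.1, ∃ b ∈ V₂ p.2, x = a ⊗ₜ[L] b}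

section Zmul

variable {N : Type*} [AddCommGroup N] [Module L N] [Module ℂ N] [IsScalarTower ℂ L N]

theorem zmul_apply (x : N) : zmul N x = (T 1 : L) • x := rfl

theorem zmul_symm_apply (x : N) : (zmul N).symm x = (T (-1) : L) • x := rfl

theorem zmul_symm_pow_apply (k : ℕ) (x : N) :
    ((zmul N).symm ^ k) x = (T (-(k : ℤ)) : L) • x := by
  induction k generalizing x with
  | zero => simp
  | succ k ih =>
    rw [pow_succ, LinearEquiv.mul_apply, ih, zmul_symm_apply, smul_smul, ← T_add]
    congr 2
    push_cast
    ring

theorem zmul_pow_apply (k : ℕ) (x : N) : ((zmul N) ^ k) x = (T (k : ℤ) : L) • x := by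
  induction k generalizing x with
  | zero => simp
  | succ k ih =>
    rw [pow_succ, LinearEquiv.mul_apply, ih, zmul_apply, smul_smul, ← T_add]
    push_cast
    rfl

theorem zmul_zpow_apply (k : ℤ) (x : N) : ((zmul N) ^ k) x = (T k : L) • x := by
  obtain ⟨n, rfl | rfl⟩ := k.eq_nat_or_neg
  · rw [zpow_natCast, zmul_pow_apply]
  · rw [zpow_neg, zpow_natCast, ← inv_pow]
    exact zmul_symm_pow_apply n x

end Zmul

namespace IsVLattice

section Jumps

variable {N : Type*} [AddCommGroup N] [Module ℂ N] {z : N ≃ₗ[ℂ] N} {V : ℝ → Submodule ℂ N}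
  {A : Finset ℝ}

/-- The jump set of a V-lattice filtration may be enlarged by `0`. -/
theorem insert_zero (h : IsVLattice z V A) : IsVLattice z V (insert 0 A) where
  mono := h.mono
  map_z := h.map_z
  zinv_stable := h.zinv_stable
  fg_zinv := h.fg_zinv
  span_laurent := h.span_laurent
  jumpsIn a ha := by
    rcases Finset.mem_insert.1 ha with rfl | ha
    · norm_num
    · exact h.jumpsIn a ha
  jumps β γ hβγ hA := h.jumps β γ hβγ fun a ha => hA a (Finset.mem_insert_of_mem ha)

/-- Each step of a V-lattice filtration is attained at the largest element of `A + ℤ` below it. -/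
theorem exists_jump_le (h : IsVLattice z V A) (hA : A.Nonempty) (γ : ℝ) :
    ∃ a ∈ A, ∃ k : ℤ, a + k ≤ γ ∧ V (a + k) = V γ := by
  obtain ⟨a, ha, hmax⟩ := A.exists_max_image (fun a => a + (⌊γ - a⌋ : ℝ)) hA
  have hle : a + (⌊γ - a⌋ : ℝ) ≤ γ := by linarith [Int.floor_le (γ - a)]
  refine ⟨a, ha, ⌊γ - a⌋, hle, h.jumps _ _ hle ?_⟩
  rintro b hb m ⟨h₁, h₂⟩
  have hm : m ≤ ⌊γ - b⌋ := Int.le_floor.2 (by linarith)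
  have hm' : (m : ℝ) ≤ ⌊γ - b⌋ := by exact_mod_cast hm
  linarith [hmax b hb]

/-- A V-lattice filtration without jumps is constant. -/
theorem eq_of_jumps_empty (h : IsVLattice z V ∅) (β γ : ℝ) : V β = V γ := by
  rcases le_total β γ with hle | hle
  · exact h.jumps β γ hle (by simp)
  · exact (h.jumps γ β hle (by simp)).symm

end Jumps

variable {N : Type*} [AddCommGroup N] [Module L N] [Module ℂ N] [IsScalarTower ℂ L N]
  {V : ℝ → Submodule ℂ N} {A : Finset ℝ}

theorem T_one_smul_mem (h : IsVLattice (zmul N) V A) {β : ℝ} {x : N} (hx : x ∈ V β) :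
    (T 1 : L) • x ∈ V (β + 1) := by
  rw [← h.map_z]
  exact ⟨x, hx, rfl⟩

theorem T_neg_one_smul_mem (h : IsVLattice (zmul N) V A) {β : ℝ} {x : N} (hx : x ∈ V β) :
    (T (-1) : L) • x ∈ V (β - 1) := by
  have hx' : x ∈ V (β - 1 + 1) := by rwa [sub_add_cancel]
  rw [← h.map_z] at hx'
  obtain ⟨y, hy, rfl⟩ := hx'
  rw [← zmul_symm_apply]
  simpa using hy

theorem T_smul_mem (h : IsVLattice (zmul N) V A) (k : ℤ) {β : ℝ} {x : N} (hx : x ∈ V β) :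
    (T k : L) • x ∈ V (β + k) := by
  induction k with
  | zero => simpa using hx
  | succ n ih =>
    have := h.T_one_smul_mem ih
    rw [smul_smul, ← T_add] at this
    convert this using 2
    · push_cast; ring
    · rw [add_comm]
  | pred n ih =>
    have := h.T_neg_one_smul_mem ih
    rw [smul_smul, ← T_add] at this
    convert this using 2
    · push_cast; ring
    · rw [sub_eq_neg_add]

end IsVLattice

section Conv

variable {N₁ N₂ : Type*}
  [AddCommGroup N₁] [Module L N₁] [Module ℂ N₁] [IsScalarTower ℂ L N₁]
  [AddCommGroup N₂] [Module L N₂] [Module ℂ N₂] [IsScalarTower ℂ L N₂]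
  {V₁ : ℝ → Submodule ℂ N₁} {V₂ : ℝ → Submodule ℂ N₂} {A₁ A₂ : Finset ℝ}

theorem smul_tmul_complex (c : ℂ) (x : N₁) (y : N₂) :
    (c • x) ⊗ₜ[L] y = x ⊗ₜ[L] (c • y) := by
  rw [← algebraMap_smul L c x, ← algebraMap_smul L c y, TensorProduct.smul_tmul]

theorem tmul_mem_of_mem_span {S₁ : Set N₁} {S₂ : Set N₂} {W : Submodule ℂ (N₁ ⊗[L] N₂)}
    (hW : ∀ s ∈ S₁, ∀ t ∈ S₂, s ⊗ₜ[L] t ∈ W) {x : N₁} {y : N₂}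
    (hx : x ∈ span ℂ S₁) (hy : y ∈ span ℂ S₂) : x ⊗ₜ[L] y ∈ W := by
  induction hx using span_induction with
  | mem s hs =>
    induction hy using span_induction with
    | mem t ht => exact hW s hs t ht
    | zero => simp
    | add t t' _ _ ht ht' => rw [TensorProduct.tmul_add]; exact W.add_mem ht ht'
    | smul c t _ ht =>
      rw [← smul_tmul_complex, ← TensorProduct.smul_tmul']
      exact W.smul_mem c ht
  | zero => simp
  | add s s' _ _ hs hs' => rw [TensorProduct.add_tmul]; exact W.add_mem hs hs'
  | smul c s _ hs => rw [← TensorProduct.smul_tmul']; exact W.smul_mem c hs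

theorem tmul_mem_conv {p q γ : ℝ} (hpq : p + q = γ) {x : N₁} {y : N₂}
    (hx : x ∈ V₁ p) (hy : y ∈ V₂ q) : x ⊗ₜ[L] y ∈ conv V₁ V₂ γ :=
  mem_iSup_of_mem (p, q) (mem_iSup_of_mem hpq (subset_span ⟨x, hx, y, hy, rfl⟩))

theorem conv_le {γ : ℝ} {W : Submodule ℂ (N₁ ⊗[L] N₂)}
    (hW : ∀ p q, p + q = γ → ∀ x ∈ V₁ p, ∀ y ∈ V₂ q, x ⊗ₜ[L] y ∈ W) : conv V₁ V₂ γ ≤ W := by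
  refine iSup₂_le fun p hp => span_le.2 ?_
  rintro _ ⟨x, hx, y, hy, rfl⟩
  exact hW _ _ hp x hx y hy

theorem conv_mono (h₁ : Monotone V₁) : Monotone (conv V₁ V₂) := fun β γ hβγ =>
  conv_le fun p q hpq x hx y hy =>
    tmul_mem_conv (p := p + (γ - β)) (q := q) (by linarith) (h₁ (by linarith) hx) hy

theorem T_smul_mem_conv (h₁ : IsVLattice (zmul N₁) V₁ A₁) (k : ℤ) {γ : ℝ} {u : N₁ ⊗[L] N₂}
    (hu : u ∈ conv V₁ V₂ γ) : (T k : L) • u ∈ conv V₁ V₂ (γ + k) := by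
  have hle : conv V₁ V₂ γ ≤
      (conv V₁ V₂ (γ + k)).comap ((zmul (N₁ ⊗[L] N₂)) ^ k).toLinearMap := by
    refine conv_le fun p q hpq x hx y hy => ?_
    rw [mem_comap, LinearEquiv.coe_coe, zmul_zpow_apply, TensorProduct.smul_tmul']
    exact tmul_mem_conv (by linarith) (h₁.T_smul_mem k hx) hy
  simpa only [mem_comap, LinearEquiv.coe_coe, zmul_zpow_apply] using hle hu

theorem map_zmul_conv (h₁ : IsVLattice (zmul N₁) V₁ A₁) (γ : ℝ) :
    (conv V₁ V₂ γ).map (zmul (N₁ ⊗[L] N₂)).toLinearMap = conv V₁ V₂ (γ + 1) := by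
  refine le_antisymm (map_le_iff_le_comap.2 fun u hu => ?_) fun u hu => ?_
  · simpa [zmul_apply] using T_smul_mem_conv h₁ 1 hu
  · refine ⟨(zmul (N₁ ⊗[L] N₂)).symm u, ?_, LinearEquiv.apply_symm_apply _ u⟩
    simpa [zmul_symm_apply] using T_smul_mem_conv h₁ (-1) hu

theorem zmul_symm_pow_mem_conv (h₁ : IsVLattice (zmul N₁) V₁ A₁) (k : ℕ) {γ : ℝ}
    {u : N₁ ⊗[L] N₂} (hu : u ∈ conv V₁ V₂ γ) :
    ((zmul (N₁ ⊗[L] N₂)).symm ^ k) u ∈ conv V₁ V₂ γ := by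
  rw [zmul_symm_pow_apply]
  exact conv_mono h₁.mono (by simp) (T_smul_mem_conv h₁ (-(k : ℤ)) hu)

theorem conv_fg (h₁ : IsVLattice (zmul N₁) V₁ A₁) (h₂ : IsVLattice (zmul N₂) V₂ A₂) (γ : ℝ) :
    ∃ S : Finset (N₁ ⊗[L] N₂), (S : Set (N₁ ⊗[L] N₂)) ⊆ conv V₁ V₂ γ ∧
      conv V₁ V₂ γ = span ℂ
        {u : N₁ ⊗[L] N₂ | ∃ k : ℕ, ∃ s ∈ S, u = ((zmul (N₁ ⊗[L] N₂)).symm ^ k) s} := by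
  classical
  choose S₁ hS₁ hV₁ using h₁.fg_zinv
  choose S₂ hS₂ hV₂ using h₂.fg_zinv
  set S : Finset (N₁ ⊗[L] N₂) := (insert 0 A₁).biUnion fun a =>
    Finset.image₂ (fun s t => s ⊗ₜ[L] t) (S₁ a) (S₂ (γ - a)) with hS
  have hSconv : (S : Set (N₁ ⊗[L] N₂)) ⊆ conv V₁ V₂ γ := by
    intro u hu
    obtain ⟨a, -, hu⟩ := Finset.mem_biUnion.1 (Finset.mem_coe.1 hu)
    obtain ⟨s, hs, t, ht, rfl⟩ := Finset.mem_image₂.1 hu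
    exact tmul_mem_conv (add_sub_cancel a γ) (hS₁ a hs) (hS₂ (γ - a) ht)
  refine ⟨S, hSconv, le_antisymm (conv_le fun p q hpq x hx y hy => ?_) (span_le.2 ?_)⟩
  · obtain ⟨a, ha, k, hak, hVk⟩ := h₁.insert_zero.exists_jump_le (Finset.insert_nonempty 0 A₁) p
    have hx' : (T (-k) : L) • x ∈ V₁ a := by
      simpa using h₁.T_smul_mem (-k) (hVk.symm ▸ hx : x ∈ V₁ (a + k))
    have hy' : (T k : L) • y ∈ V₂ (γ - a) :=
      h₂.mono (by linarith) (h₂.T_smul_mem k hy)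
    have hxy : x ⊗ₜ[L] y = ((T (-k) : L) • x) ⊗ₜ[L] ((T k : L) • y) := by
      rw [TensorProduct.smul_tmul, smul_smul, ← T_add]
      simp
    rw [hxy]
    rw [hV₁ a] at hx'
    rw [hV₂ (γ - a)] at hy'
    refine tmul_mem_of_mem_span ?_ hx' hy'
    rintro _ ⟨m, s, hs, rfl⟩ _ ⟨n, t, ht, rfl⟩
    refine subset_span ⟨m + n, s ⊗ₜ[L] t,
      Finset.mem_biUnion.2 ⟨a, ha, Finset.mem_image₂_of_mem hs ht⟩, ?_⟩
    rw [zmul_symm_pow_apply, zmul_symm_pow_apply, zmul_symm_pow_apply, TensorProduct.tmul_smul,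
      ← TensorProduct.smul_tmul', smul_smul, ← T_add]
    congr 2
    push_cast
    ring
  · rintro _ ⟨k, s, hs, rfl⟩
    exact zmul_symm_pow_mem_conv h₁ k (hSconv hs)

theorem span_laurent_conv (h₁ : IsVLattice (zmul N₁) V₁ A₁) (h₂ : IsVLattice (zmul N₂) V₂ A₂)
    (γ : ℝ) :
    span ℂ {u : N₁ ⊗[L] N₂ | ∃ k : ℤ, ∃ v ∈ conv V₁ V₂ γ, u = ((zmul (N₁ ⊗[L] N₂)) ^ k) v}
      = ⊤ := by
  refine eq_top_iff.2 fun u _ => ?_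
  induction u using TensorProduct.induction_on with
  | zero => exact zero_mem _
  | add u v hu hv => exact add_mem (hu mem_top) (hv mem_top)
  | tmul x y =>
    have hx : x ∈ (⊤ : Submodule ℂ N₁) := mem_top
    have hy : y ∈ (⊤ : Submodule ℂ N₂) := mem_top
    rw [← h₁.span_laurent γ] at hx
    rw [← h₂.span_laurent 0] at hy
    refine tmul_mem_of_mem_span ?_ hx hy
    rintro _ ⟨k, v, hv, rfl⟩ _ ⟨l, w, hw, rfl⟩
    refine subset_span ⟨l + k, v ⊗ₜ[L] w, tmul_mem_conv (add_zero γ) hv hw, ?_⟩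
    rw [zmul_zpow_apply, zmul_zpow_apply, zmul_zpow_apply, TensorProduct.tmul_smul,
      ← TensorProduct.smul_tmul', smul_smul, ← T_add]

theorem conv_eq_of_no_jump (h₁ : IsVLattice (zmul N₁) V₁ A₁) (h₂ : IsVLattice (zmul N₂) V₂ A₂)
    {β γ : ℝ} (hβγ : β ≤ γ)
    (hA : ∀ a₁ ∈ A₁, ∀ a₂ ∈ A₂, ∀ k : ℤ, ¬ (β < a₁ + a₂ + k ∧ a₁ + a₂ + k ≤ γ)) :
    conv V₁ V₂ β = conv V₁ V₂ γ := by
  refine le_antisymm (conv_mono h₁.mono hβγ) (conv_le fun p q hpq x hx y hy => ?_)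
  rcases A₁.eq_empty_or_nonempty with rfl | hA₁
  · rw [h₁.eq_of_jumps_empty p (β - q)] at hx
    exact tmul_mem_conv (sub_add_cancel β q) hx hy
  rcases A₂.eq_empty_or_nonempty with rfl | hA₂
  · rw [h₂.eq_of_jumps_empty q (β - p)] at hy
    exact tmul_mem_conv (add_sub_cancel p β) hx hy
  obtain ⟨a₁, ha₁, k, hk, hVk⟩ := h₁.exists_jump_le hA₁ p
  obtain ⟨a₂, ha₂, l, hl, hVl⟩ := h₂.exists_jump_le hA₂ q
  rw [← hVk] at hx
  rw [← hVl] at hy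
  have hle : a₁ + k + (a₂ + l) ≤ β := by
    by_contra! hlt
    refine hA a₁ ha₁ a₂ ha₂ (k + l) ⟨?_, ?_⟩ <;> push_cast <;> linarith
  exact conv_mono h₁.mono hle (tmul_mem_conv rfl hx hy)

theorem tmul_mem_Vlt_conv_left {p q γ : ℝ} (hpq : p + q = γ) {x : N₁} {y : N₂}
    (hx : x ∈ Vlt V₁ p) (hy : y ∈ V₂ q) : x ⊗ₜ[L] y ∈ Vlt (conv V₁ V₂) γ := by
  rw [Vlt, iSup_eq_span] at hx
  refine tmul_mem_of_mem_span ?_ hx (subset_span hy)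
  intro s hs t ht
  obtain ⟨δ, hs⟩ := mem_iUnion.1 hs
  by_cases hδ : δ ∈ Iio p
  · refine mem_iSup_of_mem (δ + q) (mem_iSup_of_mem ?_ (tmul_mem_conv rfl ?_ ht))
    · rw [mem_Iio] at hδ ⊢; linarith
    · simpa [hδ] using hs
  · have : s = 0 := by simpa [hδ] using hs
    simp [this]

theorem tmul_mem_Vlt_conv_right {p q γ : ℝ} (hpq : p + q = γ) {x : N₁} {y : N₂}
    (hx : x ∈ V₁ p) (hy : y ∈ Vlt V₂ q) : x ⊗ₜ[L] y ∈ Vlt (conv V₁ V₂) γ := by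
  rw [Vlt, iSup_eq_span] at hy
  refine tmul_mem_of_mem_span ?_ (subset_span hx) hy
  intro s hs t ht
  obtain ⟨δ, ht⟩ := mem_iUnion.1 ht
  by_cases hδ : δ ∈ Iio q
  · refine mem_iSup_of_mem (p + δ) (mem_iSup_of_mem ?_ (tmul_mem_conv rfl hs ?_))
    · rw [mem_Iio] at hδ ⊢; linarith
    · simpa [hδ] using ht
  · have : t = 0 := by simpa [hδ] using ht
    simp [this]

theorem shift_pow_mem {N : Type*} [AddCommGroup N] [Module ℂ N] {W : Submodule ℂ N}
    {f : N →ₗ[ℂ] N} (hf : ∀ x ∈ W, f x ∈ W) (c : ℂ) (i : ℕ) {x : N} (hx : x ∈ W) :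
    ((f + c • (LinearMap.id : N →ₗ[ℂ] N)) ^ i) x ∈ W := by
  induction i with
  | zero => simpa using hx
  | succ i ih =>
    rw [pow_succ', Module.End.mul_apply]
    exact W.add_mem (hf _ ih) (W.smul_mem c ih)

variable {nab₁ : N₁ →ₗ[ℂ] N₁} {nab₂ : N₂ →ₗ[ℂ] N₂} {nabla : N₁ ⊗[L] N₂ →ₗ[ℂ] N₁ ⊗[L] N₂}

theorem shift_tmul
    (hnabla : ∀ (x : N₁) (y : N₂),
      nabla (x ⊗ₜ[L] y) = (nab₁ x) ⊗ₜ[L] y + x ⊗ₜ[L] (nab₂ y))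
    (b c : ℂ) (x : N₁) (y : N₂) :
    (nabla + (b + c) • (LinearMap.id : N₁ ⊗[L] N₂ →ₗ[ℂ] N₁ ⊗[L] N₂)) (x ⊗ₜ[L] y) =
      ((nab₁ + b • (LinearMap.id : N₁ →ₗ[ℂ] N₁)) x) ⊗ₜ[L] y +
        x ⊗ₜ[L] ((nab₂ + c • (LinearMap.id : N₂ →ₗ[ℂ] N₂)) y) := by
  simp only [LinearMap.add_apply, LinearMap.smul_apply, LinearMap.id_apply, hnabla,
    TensorProduct.add_tmul, TensorProduct.tmul_add, ← smul_tmul_complex, add_smul,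
    TensorProduct.smul_tmul']
  abel

theorem shift_pow_tmul_mem
    (hnabla : ∀ (x : N₁) (y : N₂),
      nabla (x ⊗ₜ[L] y) = (nab₁ x) ⊗ₜ[L] y + x ⊗ₜ[L] (nab₂ y))
    (hstab₁ : ∀ β : ℝ, ∀ x ∈ V₁ β, nab₁ x ∈ V₁ β)
    (hstab₂ : ∀ β : ℝ, ∀ y ∈ V₂ β, nab₂ y ∈ V₂ β)
    {ν₁ ν₂ : ℕ}
    (hnil₁ : ∀ β : ℝ, ∀ x ∈ V₁ β,
      ((nab₁ + (β : ℂ) • (LinearMap.id : N₁ →ₗ[ℂ] N₁)) ^ ν₁) x ∈ Vlt V₁ β)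
    (hnil₂ : ∀ β : ℝ, ∀ y ∈ V₂ β,
      ((nab₂ + (β : ℂ) • (LinearMap.id : N₂ →ₗ[ℂ] N₂)) ^ ν₂) y ∈ Vlt V₂ β)
    {p q : ℝ} {x : N₁} {y : N₂} (hx : x ∈ V₁ p) (hy : y ∈ V₂ q)
    (n i j : ℕ) (hn : ν₁ + ν₂ ≤ n + i + j) :
    ((nabla + ((p : ℂ) + q) • (LinearMap.id : N₁ ⊗[L] N₂ →ₗ[ℂ] N₁ ⊗[L] N₂)) ^ n)
      ((((nab₁ + (p : ℂ) • (LinearMap.id : N₁ →ₗ[ℂ] N₁)) ^ i) x) ⊗ₜ[L]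
        (((nab₂ + (q : ℂ) • (LinearMap.id : N₂ →ₗ[ℂ] N₂)) ^ j) y)) ∈
      Vlt (conv V₁ V₂) (p + q) := by
  induction n generalizing i j with
  | zero =>
    rw [pow_zero, Module.End.one_apply]
    rcases le_or_gt ν₁ i with hi | hi
    · obtain ⟨m, rfl⟩ := Nat.exists_eq_add_of_le hi
      rw [pow_add, Module.End.mul_apply]
      exact tmul_mem_Vlt_conv_left rfl (hnil₁ p _ (shift_pow_mem (hstab₁ p) _ m hx))
        (shift_pow_mem (hstab₂ q) _ j hy)
    · obtain ⟨m, rfl⟩ := Nat.exists_eq_add_of_le (show ν₂ ≤ j by omega)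
      rw [pow_add _ ν₂, Module.End.mul_apply]
      exact tmul_mem_Vlt_conv_right rfl (shift_pow_mem (hstab₁ p) _ i hx)
        (hnil₂ q _ (shift_pow_mem (hstab₂ q) _ m hy))
  | succ n ih =>
    rw [pow_succ, Module.End.mul_apply, shift_tmul hnabla, map_add, ← Module.End.mul_apply,
      ← pow_succ', ← Module.End.mul_apply (_ + (q : ℂ) • _), ← pow_succ']
    exact add_mem (ih (i + 1) j (by omega)) (ih i (j + 1) (by omega))

theorem nabla_mem_conv
    (hnabla : ∀ (x : N₁) (y : N₂),
      nabla (x ⊗ₜ[L] y) = (nab₁ x) ⊗ₜ[L] y + x ⊗ₜ[L] (nab₂ y))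
    (hstab₁ : ∀ β : ℝ, ∀ x ∈ V₁ β, nab₁ x ∈ V₁ β)
    (hstab₂ : ∀ β : ℝ, ∀ y ∈ V₂ β, nab₂ y ∈ V₂ β) (γ : ℝ) :
    conv V₁ V₂ γ ≤ (conv V₁ V₂ γ).comap nabla :=
  conv_le fun p q hpq x hx y hy => by
    rw [mem_comap, hnabla]
    exact add_mem (tmul_mem_conv hpq (hstab₁ p x hx) hy) (tmul_mem_conv hpq hx (hstab₂ q y hy))

end Conv

/-- The Claim in the proof of Proposition 3.2.13: the convolution filtration `U` on
`N = N₁ ⊗_{ℂ[z,z⁻¹]} N₂` is a V-lattice filtration compatible with the tensor-product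
connection `∇`:
(a) it is increasing and `z·U_γ = U_{γ+1}`;
(b) each `U_γ` is stable under `z⁻¹` and finitely generated over `ℂ[z⁻¹]`;
(c) the `ℂ[z,z⁻¹]`-span of each `U_γ` is `N`;
(d) `U_β = U_γ` whenever `β ≤ γ` and `(β,γ]` contains no element of `(A₁+A₂)+ℤ`;
(e) `∇(U_γ) ⊆ U_γ`;
(f) `(∇ + γ·id)^{ν₁+ν₂}(U_γ) ⊆ U_{<γ}` for every `γ ∈ ℝ`. -/
theorem statement8
    (M₁ : Submodule ℂ N₁) (M₂ : Submodule ℂ N₂) (r₁ r₂ : ℕ)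
    (V₁ : ℝ → Submodule ℂ N₁) (V₂ : ℝ → Submodule ℂ N₂) (A₁ A₂ : Finset ℝ)
    (hM₁ : IsFreeLattice (zmul N₁) M₁ r₁) (hM₂ : IsFreeLattice (zmul N₂) M₂ r₂)
    (hV₁ : IsVLattice (zmul N₁) V₁ A₁) (hV₂ : IsVLattice (zmul N₂) V₂ A₂)
    (nab₁ : N₁ →ₗ[ℂ] N₁) (nab₂ : N₂ →ₗ[ℂ] N₂)
    -- the Leibniz rule `∇(f·n) = −z·(df/dz)·n + f·∇(n)` (on the generator `f = z`,
    -- which determines it for all `f ∈ ℂ[z,z⁻¹]`):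
    (hLeib₁ : ∀ x : N₁, nab₁ ((T 1 : L) • x) = (T 1 : L) • nab₁ x - (T 1 : L) • x)
    (hLeib₂ : ∀ y : N₂, nab₂ ((T 1 : L) • y) = (T 1 : L) • nab₂ y - (T 1 : L) • y)
    (hstab₁ : ∀ β : ℝ, ∀ x ∈ V₁ β, nab₁ x ∈ V₁ β)
    (hstab₂ : ∀ β : ℝ, ∀ y ∈ V₂ β, nab₂ y ∈ V₂ β)
    (ν₁ ν₂ : ℕ)
    (hnil₁ : ∀ β : ℝ, ∀ x ∈ V₁ β,
      ((nab₁ + (β : ℂ) • (LinearMap.id : N₁ →ₗ[ℂ] N₁)) ^ ν₁) x ∈ Vlt V₁ β)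
    (hnil₂ : ∀ β : ℝ, ∀ y ∈ V₂ β,
      ((nab₂ + (β : ℂ) • (LinearMap.id : N₂ →ₗ[ℂ] N₂)) ^ ν₂) y ∈ Vlt V₂ β)
    -- the (unique) tensor-product connection on `N = N₁ ⊗_{ℂ[z,z⁻¹]} N₂`:
    (nabla : N₁ ⊗[L] N₂ →ₗ[ℂ] N₁ ⊗[L] N₂)
    (hnabla : ∀ (x : N₁) (y : N₂),
      nabla (x ⊗ₜ[L] y) = (nab₁ x) ⊗ₜ[L] y + x ⊗ₜ[L] (nab₂ y)) :
    -- (a)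
    (Monotone (conv V₁ V₂) ∧
      ∀ γ : ℝ, (conv V₁ V₂ γ).map (zmul (N₁ ⊗[L] N₂)).toLinearMap = conv V₁ V₂ (γ + 1)) ∧
    -- (b)
    ((∀ γ : ℝ, ∀ u ∈ conv V₁ V₂ γ, (zmul (N₁ ⊗[L] N₂)).symm u ∈ conv V₁ V₂ γ) ∧
      ∀ γ : ℝ, ∃ S : Finset (N₁ ⊗[L] N₂), (S : Set (N₁ ⊗[L] N₂)) ⊆ conv V₁ V₂ γ ∧
        conv V₁ V₂ γ = Submodule.span ℂ
          {u : N₁ ⊗[L] N₂ | ∃ k : ℕ, ∃ s ∈ S, u = ((zmul (N₁ ⊗[L] N₂)).symm ^ k) s}) ∧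
    -- (c)
    (∀ γ : ℝ, Submodule.span ℂ
        {u : N₁ ⊗[L] N₂ | ∃ k : ℤ, ∃ v ∈ conv V₁ V₂ γ, u = ((zmul (N₁ ⊗[L] N₂)) ^ k) v}
        = ⊤) ∧
    -- (d)
    (∀ β γ : ℝ, β ≤ γ →
      (∀ a₁ ∈ A₁, ∀ a₂ ∈ A₂, ∀ k : ℤ, ¬ (β < a₁ + a₂ + k ∧ a₁ + a₂ + k ≤ γ)) →
      conv V₁ V₂ β = conv V₁ V₂ γ) ∧
    -- (e)
    (∀ γ : ℝ, ∀ u ∈ conv V₁ V₂ γ, nabla u ∈ conv V₁ V₂ γ) ∧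
    -- (f)
    (∀ γ : ℝ, ∀ u ∈ conv V₁ V₂ γ,
      ((nabla + (γ : ℂ) • (LinearMap.id : N₁ ⊗[L] N₂ →ₗ[ℂ] N₁ ⊗[L] N₂)) ^ (ν₁ + ν₂)) u ∈
        Vlt (conv V₁ V₂) γ) := by
  refine ⟨⟨conv_mono hV₁.mono, map_zmul_conv hV₁⟩,
    ⟨fun γ u hu => by simpa using zmul_symm_pow_mem_conv hV₁ 1 hu, conv_fg hV₁ hV₂⟩,
    span_laurent_conv hV₁ hV₂, fun β γ hβγ hA => conv_eq_of_no_jump hV₁ hV₂ hβγ hA,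
    fun γ u hu => nabla_mem_conv hnabla hstab₁ hstab₂ γ hu, fun γ u hu => ?_⟩
  have hle : conv V₁ V₂ γ ≤ (Vlt (conv V₁ V₂) γ).comap
      ((nabla + (γ : ℂ) • (LinearMap.id : N₁ ⊗[L] N₂ →ₗ[ℂ] N₁ ⊗[L] N₂)) ^ (ν₁ + ν₂)) := by
    refine conv_le fun p q hpq x hx y hy => ?_
    subst hpq
    simpa using shift_pow_tmul_mem hnabla hstab₁ hstab₂ hnil₁ hnil₂ hx hy (ν₁ + ν₂) 0 0 (by simp)
  exact hle hu
end
end
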